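/- If [i_1,…,i_K] and [i'_1,…,i'_K] are stepping sequences for m−1 (so K = 2^{m−1} − m), then the concatenation [i_1, i_2, …, i_K] ++ [m−1, m−2, …, 1] ++ [i'_1+1, i'_2+1, …, i'_K+1] is a stepping sequence for m. -/

import Mathlib

open List

/-- The initial configuration `(1, 2, …, m)`. -/
def initConfig (m : ℕ) : List ℕ := (List.range m).map (· + 1)

/-- A move at index `i` (with `1 ≤ i ≤ m-1`) transposes the entries `q_i` and `q_{i+1}`
(one-indexed), i.e. the entries at zero-indexed positions `i-1` and `i`. -/
def swapAdj (q : List ℕ) (i : ℕ) : List ℕ :=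
  (q.set (i - 1) (q.getD i 0)).set i (q.getD (i - 1) 0)

/-- The prefix set `S_k(q) = {q_1, …, q_k}`. -/
def prefixSet (q : List ℕ) (k : ℕ) : Finset ℕ := (q.take k).toFinset

/-- The initial prefix sets `S_0 ⊂ S_1 ⊂ … ⊂ S_m` of the configuration `(1,…,m)`. -/
def initSets (m : ℕ) : List (Finset ℕ) :=
  (List.range (m + 1)).map (fun k => prefixSet (initConfig m) k)

/-- The sets generated by applying a sequence of moves starting from configuration `q`:
the `t`-th generated set is the prefix set of length `i_t` of the configuration
obtained after the `t`-th move. -/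
def genSetsAux (q : List ℕ) : List ℕ → List (Finset ℕ)
  | [] => []
  | i :: rest => prefixSet (swapAdj q i) i :: genSetsAux (swapAdj q i) rest

/-- The sets generated by the moves, starting from the initial configuration `(1,…,m)`. -/
def genSets (m : ℕ) (moves : List ℕ) : List (Finset ℕ) :=
  genSetsAux (initConfig m) moves

/-- `moves` is a stepping sequence for `m`: each move index lies in `{1,…,m-1}`, and the
initial prefix sets `S_0,…,S_m` together with the generated sets list every subset of
`{1,…,m}` exactly once. -/
def IsSteppingSeq (m : ℕ) (moves : List ℕ) : Prop :=
  (∀ i ∈ moves, 1 ≤ i ∧ i ≤ m - 1) ∧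
  (initSets m ++ genSets m moves).Perm (Finset.Icc 1 m).powerset.toList

theorem swapAdj_length (q : List ℕ) (i : ℕ) : (swapAdj q i).length = q.length := by
  simp [swapAdj]

theorem swapAdj_append_pair (q r : List ℕ) (x y : ℕ) :
    swapAdj (q ++ x :: y :: r) (q.length + 1) = q ++ y :: x :: r := by
  simp [swapAdj]

theorem exists_eq_append_pair {q : List ℕ} {i : ℕ} (h1 : 1 ≤ i) (h2 : i < q.length) :
    ∃ l r x y, q = l ++ x :: y :: r ∧ i = l.length + 1 := by
  obtain ⟨i, rfl⟩ : ∃ k, i = k + 1 := ⟨i - 1, by omega⟩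
  refine ⟨q.take i, q.drop (i + 2), q[i], q[i + 1], ?_, ?_⟩
  · rw [← List.drop_eq_getElem_cons, ← List.drop_eq_getElem_cons, List.take_append_drop]
  · simp; omega

theorem swapAdj_perm {q : List ℕ} {i : ℕ} (h1 : 1 ≤ i) (h2 : i < q.length) :
    (swapAdj q i).Perm q := by
  obtain ⟨l, r, x, y, rfl, rfl⟩ := exists_eq_append_pair h1 h2
  rw [swapAdj_append_pair]
  exact (List.Perm.swap _ _ _).append_left _

theorem swapAdj_append {q : List ℕ} {i : ℕ} (r : List ℕ) (h1 : 1 ≤ i) (h2 : i < q.length) :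
    swapAdj (q ++ r) i = swapAdj q i ++ r := by
  obtain ⟨l, s, x, y, rfl, rfl⟩ := exists_eq_append_pair h1 h2
  rw [swapAdj_append_pair, List.append_assoc, List.append_assoc]
  exact swapAdj_append_pair _ _ _ _

theorem swapAdj_cons {q : List ℕ} {i : ℕ} (x : ℕ) (h1 : 1 ≤ i) (h2 : i < q.length) :
    swapAdj (x :: q) (i + 1) = x :: swapAdj q i := by
  obtain ⟨l, s, y, z, rfl, rfl⟩ := exists_eq_append_pair h1 h2
  rw [swapAdj_append_pair]
  exact swapAdj_append_pair (x :: l) _ _ _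

theorem swapAdj_map {q : List ℕ} {i : ℕ} (f : ℕ → ℕ) (h1 : 1 ≤ i) (h2 : i < q.length) :
    swapAdj (q.map f) i = (swapAdj q i).map f := by
  obtain ⟨l, s, y, z, rfl, rfl⟩ := exists_eq_append_pair h1 h2
  rw [swapAdj_append_pair]
  simpa using swapAdj_append_pair (l.map f) (s.map f) (f y) (f z)

theorem prefixSet_append {q : List ℕ} {k : ℕ} (r : List ℕ) (h : k ≤ q.length) :
    prefixSet (q ++ r) k = prefixSet q k := by
  simp [prefixSet, List.take_append_of_le_length h]

theorem prefixSet_cons (x : ℕ) (q : List ℕ) (k : ℕ) :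
    prefixSet (x :: q) (k + 1) = insert x (prefixSet q k) := by
  simp [prefixSet]

theorem prefixSet_map (f : ℕ → ℕ) (q : List ℕ) (k : ℕ) :
    prefixSet (q.map f) k = (prefixSet q k).image f := by
  ext; simp [prefixSet, ← List.map_take]

theorem genSetsAux_append (q A B : List ℕ) :
    genSetsAux q (A ++ B) = genSetsAux q A ++ genSetsAux (A.foldl swapAdj q) B := by
  induction A generalizing q with
  | nil => rfl
  | cons i A ih => simp [genSetsAux, ih]

theorem foldl_swapAdj_perm {q A : List ℕ} (h : ∀ i ∈ A, 1 ≤ i ∧ i < q.length) :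
    (A.foldl swapAdj q).Perm q := by
  induction A generalizing q with
  | nil => rfl
  | cons i A ih =>
    simp only [List.forall_mem_cons] at h
    exact (ih (by simpa [swapAdj_length] using h.2)).trans (swapAdj_perm h.1.1 h.1.2)

theorem foldl_swapAdj_append {q A : List ℕ} (r : List ℕ)
    (h : ∀ i ∈ A, 1 ≤ i ∧ i < q.length) :
    A.foldl swapAdj (q ++ r) = A.foldl swapAdj q ++ r := by
  induction A generalizing q with
  | nil => rfl
  | cons i A ih =>
    simp only [List.forall_mem_cons] at h
    rw [List.foldl_cons, List.foldl_cons, swapAdj_append r h.1.1 h.1.2,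
      ih (by simpa [swapAdj_length] using h.2)]

theorem genSetsAux_append_config {q A : List ℕ} (r : List ℕ)
    (h : ∀ i ∈ A, 1 ≤ i ∧ i < q.length) :
    genSetsAux (q ++ r) A = genSetsAux q A := by
  induction A generalizing q with
  | nil => rfl
  | cons i A ih =>
    simp only [List.forall_mem_cons] at h
    rw [genSetsAux, genSetsAux, swapAdj_append r h.1.1 h.1.2,
      ih (by simpa [swapAdj_length] using h.2),
      prefixSet_append r (by rw [swapAdj_length]; exact h.1.2.le)]

theorem genSetsAux_cons {q A : List ℕ} (x : ℕ) (h : ∀ i ∈ A, 1 ≤ i ∧ i < q.length) :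
    genSetsAux (x :: q) (A.map (· + 1)) = (genSetsAux q A).map (insert x) := by
  induction A generalizing q with
  | nil => rfl
  | cons i A ih =>
    simp only [List.forall_mem_cons] at h
    rw [List.map_cons, genSetsAux, genSetsAux, swapAdj_cons x h.1.1 h.1.2,
      ih (by simpa [swapAdj_length] using h.2), prefixSet_cons, List.map_cons]

theorem genSetsAux_map {q A : List ℕ} (f : ℕ → ℕ) (h : ∀ i ∈ A, 1 ≤ i ∧ i < q.length) :
    genSetsAux (q.map f) A = (genSetsAux q A).map (Finset.image f) := by
  induction A generalizing q with
  | nil => rfl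
  | cons i A ih =>
    simp only [List.forall_mem_cons] at h
    rw [genSetsAux, genSetsAux, swapAdj_map f h.1.1 h.1.2,
      ih (by simpa [swapAdj_length] using h.2), prefixSet_map, List.map_cons]

theorem foldl_swapAdj_descending (q : List ℕ) (x : ℕ) :
    ((List.range q.length).map (· + 1)).reverse.foldl swapAdj (q ++ [x]) = x :: q := by
  induction q using List.reverseRecOn generalizing x with
  | nil => rfl
  | append_singleton q y ih =>
    have h := swapAdj_append_pair q [] y x
    simp only [List.length_append, List.length_singleton, List.range_succ, List.map_append,
      List.map_singleton, List.reverse_append, List.reverse_singleton, List.singleton_append,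
      List.foldl_cons, List.append_assoc, h]
    rw [show q ++ [x, y] = (q ++ [x]) ++ [y] by simp, foldl_swapAdj_append, ih]
    · rfl
    · simp

theorem genSetsAux_descending (q : List ℕ) (x : ℕ) :
    genSetsAux (q ++ [x]) ((List.range q.length).map (· + 1)).reverse =
      ((List.range q.length).map fun j => insert x (prefixSet q j)).reverse := by
  induction q using List.reverseRecOn generalizing x with
  | nil => rfl
  | append_singleton q y ih =>
    have h := swapAdj_append_pair q [] y x
    simp only [List.length_append, List.length_singleton, List.range_succ, List.map_append,
      List.map_singleton, List.reverse_append, List.reverse_singleton, List.singleton_append,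
      genSetsAux, List.append_assoc, h]
    rw [show q ++ [x, y] = (q ++ [x]) ++ [y] by simp, genSetsAux_append_config, ih]
    · congr 1
      · rw [prefixSet_append _ (by simp), prefixSet_append _ le_rfl]
        ext; simp [prefixSet, List.take_of_length_le]
      · congr 1
        refine List.map_congr_left fun j hj => ?_
        rw [prefixSet_append _ (List.mem_range.1 hj).le]
    · simp

theorem initConfig_length (m : ℕ) : (initConfig m).length = m := by
  simp [initConfig]

theorem initConfig_succ (m : ℕ) : initConfig (m + 1) = initConfig m ++ [m + 1] := by
  simp [initConfig, List.range_succ]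

theorem initConfig_toFinset (m : ℕ) : (initConfig m).toFinset = Finset.Icc 1 m := by
  ext a
  simp only [initConfig, List.mem_toFinset, List.mem_map, List.mem_range, Finset.mem_Icc]
  exact ⟨by rintro ⟨b, hb, rfl⟩; omega, fun h => ⟨a - 1, by omega, by omega⟩⟩

theorem initConfig_nodup (m : ℕ) : (initConfig m).Nodup :=
  List.nodup_range.map (add_left_injective 1)

theorem initSets_succ (m : ℕ) :
    initSets (m + 1) = initSets m ++ [Finset.Icc 1 (m + 1)] := by
  unfold initSets
  rw [List.range_succ, List.map_append]
  congr 1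
  · refine List.map_congr_left fun j hj => ?_
    rw [initConfig_succ, prefixSet_append]
    rw [initConfig_length]
    exact Nat.lt_succ_iff.1 (List.mem_range.1 hj)
  · rw [List.map_singleton, prefixSet, List.take_of_length_le (initConfig_length _).le,
      initConfig_toFinset]

/-- Every rearrangement of the initial configuration is a relabelling of it. -/
theorem exists_map_initConfig {n : ℕ} {p : List ℕ} (h : p.Perm (initConfig n)) :
    ∃ f : ℕ → ℕ, p = (initConfig n).map f := by
  refine ⟨fun i => p.getD (i - 1) 0, ?_⟩
  have hl : p.length = n := h.length_eq.trans (initConfig_length n)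
  refine List.ext_getElem (by simp [initConfig_length, hl]) fun i h1 h2 => ?_
  simp [initConfig, h1]

theorem powerset_Icc_succ_perm {n : ℕ} {f : ℕ → ℕ} (hf : Set.InjOn f (Finset.Icc 1 n))
    (hi : (Finset.Icc 1 n).image f = Finset.Icc 1 n) :
    ((Finset.Icc 1 n).powerset.toList ++
      (Finset.Icc 1 n).powerset.toList.map fun s => insert (n + 1) (s.image f)).Perm
      (Finset.Icc 1 (n + 1)).powerset.toList := by
  have hsub : ∀ s ⊆ Finset.Icc 1 n, n + 1 ∉ s := fun s hs h => by simpa using hs h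
  have himg : ∀ s ⊆ Finset.Icc 1 n, s.image f ⊆ Finset.Icc 1 n := fun s hs =>
    hi ▸ Finset.image_subset_image hs
  rw [List.perm_ext_iff_of_nodup]
  · intro s
    rw [← Finset.insert_Icc_right_eq_Icc_add_one (by omega), Finset.powerset_insert]
    simp only [List.mem_append, Finset.mem_toList, List.mem_map, Finset.mem_union,
      Finset.mem_image, Finset.mem_powerset]
    refine or_congr_right ⟨?_, ?_⟩
    · rintro ⟨t, ht, rfl⟩
      exact ⟨t.image f, himg t ht, rfl⟩
    · rintro ⟨t, ht, rfl⟩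
      rw [← hi] at ht
      obtain ⟨u, hu, rfl⟩ := Finset.subset_image_iff.1 ht
      exact ⟨u, by exact_mod_cast hu, rfl⟩
  · refine List.Nodup.append (Finset.nodup_toList _) ?_ ?_
    · refine List.Nodup.map_on ?_ (Finset.nodup_toList _)
      intro s hs t ht h
      simp only [Finset.mem_toList, Finset.mem_powerset] at hs ht
      have h' : s.image f = t.image f := by
        rw [← Finset.erase_insert (hsub _ (himg s hs)), h,
          Finset.erase_insert (hsub _ (himg t ht))]
      refine Finset.coe_injective ((hf.image_eq_image_iff ?_ ?_).1 (by exact_mod_cast h'))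
      · exact_mod_cast hs
      · exact_mod_cast ht
    · intro s hs h
      simp only [Finset.mem_toList, Finset.mem_powerset, List.mem_map] at hs h
      obtain ⟨t, -, rfl⟩ := h
      exact hsub _ hs (Finset.mem_insert_self _ _)
  · exact Finset.nodup_toList _

/-- Theorem 2.1, second recursion: if `A` and `B` are stepping sequences for `m-1`, then
`A ++ [m-1,m-2,…,1] ++ (B+1)` is a stepping sequence for `m`. -/
theorem stepping_recursion_two (m : ℕ) (hm : 3 ≤ m) (A B : List ℕ)
    (hA : IsSteppingSeq (m - 1) A) (hB : IsSteppingSeq (m - 1) B) :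
    IsSteppingSeq m
      (A ++ ((List.range (m - 1)).map (· + 1)).reverse ++ B.map (· + 1)) := by
  obtain ⟨n, rfl⟩ : ∃ n, m = n + 1 := ⟨m - 1, by omega⟩
  rw [Nat.add_sub_cancel] at *
  obtain ⟨hA1, hA2⟩ := hA
  obtain ⟨hB1, hB2⟩ := hB
  refine ⟨?_, ?_⟩
  · intro i hi
    simp only [List.mem_append, List.mem_reverse, List.mem_map, List.mem_range] at hi
    rcases hi with (hi | ⟨j, hj, rfl⟩) | ⟨j, hj, rfl⟩
    · have := hA1 i hi; omega
    · omega
    · have := hB1 j hj; omega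
  have hA1' : ∀ i ∈ A, 1 ≤ i ∧ i < (initConfig n).length := fun i hi => by
    have := hA1 i hi; rw [initConfig_length]; omega
  have hB1' : ∀ i ∈ B, 1 ≤ i ∧ i < (initConfig n).length := fun i hi => by
    have := hB1 i hi; rw [initConfig_length]; omega
  have hp := foldl_swapAdj_perm hA1'
  obtain ⟨f, hf⟩ := exists_map_initConfig hp
  rw [hf] at hp
  have hi : (Finset.Icc 1 n).image f = Finset.Icc 1 n := by
    have := List.toFinset_eq_of_perm _ _ hp
    rw [← initConfig_toFinset]
    refine Eq.trans ?_ this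
    ext; simp
  have hinj : Set.InjOn f (Finset.Icc 1 n) := by
    have := List.inj_on_of_nodup_map (hp.nodup_iff.2 (initConfig_nodup n))
    intro a ha b hb hab
    rw [← initConfig_toFinset, List.coe_toFinset] at ha hb
    exact this ha hb hab
  have hgen : genSets (n + 1)
      (A ++ ((List.range n).map (· + 1)).reverse ++ B.map (· + 1)) =
      genSets n A ++
        ((List.range n).map fun j =>
          insert (n + 1) ((prefixSet (initConfig n) j).image f)).reverse ++
        (genSets n B).map fun s => insert (n + 1) (s.image f) := by
    have hl : ((initConfig n).map f).length = n := by simp [initConfig_length]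
    have h1 := genSetsAux_descending ((initConfig n).map f) (n + 1)
    have h2 := foldl_swapAdj_descending ((initConfig n).map f) (n + 1)
    rw [hl] at h1 h2
    simp only [genSets]
    rw [genSetsAux_append, genSetsAux_append, initConfig_succ, List.foldl_append,
      genSetsAux_append_config _ hA1', foldl_swapAdj_append _ hA1', hf, h1, h2,
      genSetsAux_cons _ (by simpa using hB1'), genSetsAux_map f hB1', List.map_map]
    simp only [prefixSet_map]
    rfl
  have hfull : insert (n + 1) ((prefixSet (initConfig n) n).image f) =
      Finset.Icc 1 (n + 1) := by
    rw [prefixSet, List.take_of_length_le (initConfig_length _).le, initConfig_toFinset, hi,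
      Finset.insert_Icc_right_eq_Icc_add_one (by omega)]
  refine List.Perm.trans ?_ (powerset_Icc_succ_perm hinj hi)
  refine List.Perm.trans ?_ (hA2.append (hB2.map _))
  rw [hgen, initSets_succ, List.map_append]
  have hS : (initSets n).map (fun s => insert (n + 1) (s.image f)) =
      ((List.range n).map fun j =>
        insert (n + 1) ((prefixSet (initConfig n) j).image f)) ++ [Finset.Icc 1 (n + 1)] := by
    rw [initSets, List.map_map, List.range_succ, List.map_append, List.map_singleton,
      Function.comp_apply, hfull]
    rfl
  rw [hS, ← Multiset.coe_eq_coe]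
  simp only [← Multiset.coe_add, Multiset.coe_reverse]
  abel
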